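/- Let M_alpha, M_beta, M_gamma be Hausdorff topological spaces with flows phi_alpha, phi_beta, phi_gamma, and let h_ba : M_alpha -> M_beta and h_gb : M_beta -> M_gamma be flow maps. Let N_gamma be an isolating neighborhood for phi_gamma, set S_gamma = Inv(N_gamma, phi_gamma), and let f_gamma : M_gamma -> R be a continuous function which is constant on S_gamma and such that for every q in M_gamma the function t ↦ f_gamma(phi_gamma(t,q)) is differentiable on R with nonpositive derivative, and whose derivative at t = 0 is strictly negative whenever q in N_gamma \ S_gamma. Set N_alpha = (h_gb ∘ h_ba)^{-1}(N_gamma). Then N_alpha is an isolating neighborhood for phi_alpha and, for every R' >= 0, the composition h_gb ∘ (phi_beta)_{R'} ∘ h_ba : M_alpha -> M_gamma, where (phi_beta)_{R'}(q) = phi_beta(R', q), is an isolated map with respect to N_alpha and N_gamma (for the flows phi_alpha and phi_gamma). -/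

import Mathlib

open Set

/-- A flow on a topological space `M`: a continuous map `ℝ × M → M` with
`φ 0 x = x` and `φ (t+s) x = φ t (φ s x)`. -/
def IsFlow {M : Type*} [TopologicalSpace M] (φ : ℝ → M → M) : Prop :=
  Continuous (fun q : ℝ × M => φ q.1 q.2) ∧ (∀ x, φ 0 x = x) ∧
    (∀ t s x, φ (t + s) x = φ t (φ s x))

/-- The maximal invariant set `Inv(N, φ)` inside `N`. -/
def maxInv {M : Type*} (φ : ℝ → M → M) (N : Set M) : Set M :=
  {x | x ∈ N ∧ ∀ t : ℝ, φ t x ∈ N}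

/-- `N` is an isolating neighborhood for the flow `φ`. -/
def IsIsolatingNbhd {M : Type*} [TopologicalSpace M] (φ : ℝ → M → M) (N : Set M) : Prop :=
  IsCompact N ∧ maxInv φ N ⊆ interior N

/-- The backward orbit `O₋(p) = {φ t p | t ≤ 0}`. -/
def backOrbit {M : Type*} (φ : ℝ → M → M) (p : M) : Set M :=
  {q | ∃ t ≤ (0 : ℝ), φ t p = q}

/-- The forward orbit `O₊(p) = {φ t p | t ≥ 0}`. -/
def fwdOrbit {M : Type*} (φ : ℝ → M → M) (p : M) : Set M :=
  {q | ∃ t ≥ (0 : ℝ), φ t p = q}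

/-- A flow map: a continuous proper equivariant map. -/
def IsFlowMap {Mα Mβ : Type*} [TopologicalSpace Mα] [TopologicalSpace Mβ]
    (φα : ℝ → Mα → Mα) (φβ : ℝ → Mβ → Mβ) (h : Mα → Mβ) : Prop :=
  Continuous h ∧ (∀ K : Set Mβ, IsCompact K → IsCompact (h ⁻¹' K)) ∧
    (∀ (t : ℝ) (p : Mα), h (φα t p) = φβ t (h p))

/-- `h` is an isolated map with respect to the isolating neighborhoods `Nα`, `Nβ`. -/
def IsIsolatedMap {Mα Mβ : Type*} [TopologicalSpace Mα] [TopologicalSpace Mβ]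
    (φα : ℝ → Mα → Mα) (φβ : ℝ → Mβ → Mβ) (Nα : Set Mα) (Nβ : Set Mβ)
    (h : Mα → Mβ) : Prop :=
  ∀ p ∈ Nα, backOrbit φα p ⊆ Nα → fwdOrbit φβ (h p) ⊆ Nβ →
    backOrbit φα p ⊆ interior Nα ∧ fwdOrbit φβ (h p) ⊆ interior Nβ

open Filter Topology

section Flow

variable {M : Type*} [TopologicalSpace M] {φ : ℝ → M → M} {N : Set M}

theorem IsFlow.continuous_time (hφ : IsFlow φ) (t : ℝ) : Continuous (φ t) :=
  hφ.1.comp (Continuous.prodMk_right t)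

theorem IsFlow.map_mem_maxInv (hφ : IsFlow φ) {x : M} (hx : x ∈ maxInv φ N) (t : ℝ) :
    φ t x ∈ maxInv φ N :=
  ⟨hx.2 t, fun s => hφ.2.2 s t x ▸ hx.2 (s + t)⟩

/-- An orbit which eventually stays in a closed compact set `N`, along a translation invariant
filter of times, accumulates at a point of the maximal invariant set of `N`. -/
theorem IsFlow.exists_mapClusterPt_mem_maxInv (hφ : IsFlow φ) (hN : IsCompact N)
    (hNc : IsClosed N) {l : Filter ℝ} [l.NeBot] (hl : ∀ s, Tendsto (s + ·) l l) {q : M}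
    (hq : ∀ᶠ t in l, φ t q ∈ N) :
    ∃ y ∈ maxInv φ N, MapClusterPt y l (fun t => φ t q) := by
  obtain ⟨y, hyN, hy⟩ := hN.exists_mapClusterPt (tendsto_principal.2 hq)
  refine ⟨y, ⟨hyN, fun s => ?_⟩, hy⟩
  have hcl := hy.continuousAt_comp (hφ.continuous_time s).continuousAt
  refine hNc.mem_of_mapClusterPt hcl ?_
  filter_upwards [(hl s).eventually hq] with t ht
  simpa [hφ.2.2] using ht

/-- If a function which is constant on the maximal invariant set of `N` is nonincreasing along an
orbit that lies in `N` for all large negative and all large positive times, then it is constant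
along that orbit. -/
theorem IsFlow.exists_forall_eq_of_antitone (hφ : IsFlow φ) (hN : IsCompact N)
    (hNc : IsClosed N) {f : M → ℝ} (hf : Continuous f)
    (hconst : ∀ x ∈ maxInv φ N, ∀ y ∈ maxInv φ N, f x = f y) {q : M}
    (hanti : Antitone fun t => f (φ t q))
    (hbot : ∀ᶠ t in atBot, φ t q ∈ N) (htop : ∀ᶠ t in atTop, φ t q ∈ N) :
    ∃ c, ∀ t, f (φ t q) = c := by
  obtain ⟨y, hy, hyc⟩ := hφ.exists_mapClusterPt_mem_maxInv hN hNc
    (fun s => tendsto_atTop_add_const_left _ s tendsto_id) htop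
  obtain ⟨z, hz, hzc⟩ := hφ.exists_mapClusterPt_mem_maxInv hN hNc
    (fun s => tendsto_atBot_add_const_left _ s tendsto_id) hbot
  refine ⟨f y, fun t => le_antisymm ?_ ?_⟩
  · rw [hconst y hy z hz]
    exact isClosed_Ici.mem_of_mapClusterPt (hzc.continuousAt_comp hf.continuousAt)
      ((eventually_le_atBot t).mono fun _ hs => hanti hs)
  · exact isClosed_Iic.mem_of_mapClusterPt (hyc.continuousAt_comp hf.continuousAt)
      ((eventually_ge_atTop t).mono fun _ hs => hanti hs)

end Flow

/-- for flow maps into a gradient-like flow with a Lyapunov function,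
the compositions `h_gb ∘ (φβ)_{R'} ∘ h_ba` are isolated maps for all `R' ≥ 0`. -/
theorem composition_with_flow_isolated
    {Mα Mβ Mγ : Type*} [TopologicalSpace Mα] [TopologicalSpace Mβ] [TopologicalSpace Mγ]
    [T2Space Mα] [T2Space Mβ] [T2Space Mγ]
    (φα : ℝ → Mα → Mα) (φβ : ℝ → Mβ → Mβ) (φγ : ℝ → Mγ → Mγ)
    (hφα : IsFlow φα) (hφβ : IsFlow φβ) (hφγ : IsFlow φγ)
    (hba : Mα → Mβ) (hgb : Mβ → Mγ)
    (hba_fm : IsFlowMap φα φβ hba) (hgb_fm : IsFlowMap φβ φγ hgb)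
    (Nγ : Set Mγ) (hNγ : IsIsolatingNbhd φγ Nγ)
    (fγ : Mγ → ℝ) (hfc : Continuous fγ)
    (hconst : ∀ x ∈ maxInv φγ Nγ, ∀ y ∈ maxInv φγ Nγ, fγ x = fγ y)
    (hderiv : ∀ (q : Mγ) (t : ℝ), DifferentiableAt ℝ (fun s : ℝ => fγ (φγ s q)) t ∧
      deriv (fun s : ℝ => fγ (φγ s q)) t ≤ 0)
    (hneg : ∀ q ∈ Nγ \ maxInv φγ Nγ, deriv (fun s : ℝ => fγ (φγ s q)) 0 < 0) :
    IsIsolatingNbhd φα ((hgb ∘ hba) ⁻¹' Nγ) ∧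
      ∀ R' ≥ (0 : ℝ),
        IsIsolatedMap φα φγ ((hgb ∘ hba) ⁻¹' Nγ) Nγ
          (fun p => hgb (φβ R' (hba p))) := by
  obtain ⟨hN, hNint⟩ := hNγ
  have hcont : Continuous (hgb ∘ hba) := hgb_fm.1.comp hba_fm.1
  have heq : ∀ t p, (hgb ∘ hba) (φα t p) = φγ t ((hgb ∘ hba) p) := fun t p => by
    simp [hba_fm.2.2, hgb_fm.2.2]
  have hpre : ∀ x, (hgb ∘ hba) x ∈ maxInv φγ Nγ → x ∈ interior ((hgb ∘ hba) ⁻¹' Nγ) :=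
    fun x hx => preimage_interior_subset_interior_preimage hcont (hNint hx)
  refine ⟨⟨hba_fm.2.1 _ (hgb_fm.2.1 _ hN), fun x hx => hpre x ⟨hx.1, fun t => ?_⟩⟩, ?_⟩
  · exact heq t x ▸ hx.2 t
  intro R' _ p hp hback hfwd
  set q := (hgb ∘ hba) p
  have hshift : ∀ t, φγ t (hgb (φβ R' (hba p))) = φγ (t + R') q := fun t => by
    rw [hgb_fm.2.2, hφγ.2.2]; rfl
  have hanti : Antitone fun t => fγ (φγ t q) :=
    antitone_of_deriv_nonpos (fun t => (hderiv q t).1) fun t => (hderiv q t).2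
  have hbot : ∀ᶠ t in atBot, φγ t q ∈ Nγ := by
    filter_upwards [eventually_le_atBot 0] with t ht
    exact heq t p ▸ hback ⟨t, ht, rfl⟩
  have htop : ∀ᶠ t in atTop, φγ t q ∈ Nγ := by
    filter_upwards [eventually_ge_atTop R'] with t ht
    have := hfwd ⟨t - R', sub_nonneg.2 ht, rfl⟩
    rwa [hshift, sub_add_cancel] at this
  obtain ⟨c, hc⟩ := hφγ.exists_forall_eq_of_antitone hN hN.isClosed hfc hconst hanti hbot htop
  have hqS : q ∈ maxInv φγ Nγ := by
    by_contra hqS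
    simpa [hc] using hneg q ⟨hp, hqS⟩
  constructor
  · rintro _ ⟨t, -, rfl⟩
    exact hpre _ (heq t p ▸ hφγ.map_mem_maxInv hqS t)
  · rintro _ ⟨t, -, rfl⟩
    exact hNint (hshift t ▸ hφγ.map_mem_maxInv hqS _)
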